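/- Let b>0, let l≥−1/2 be real, and let q:[0,b]→ℂ be continuous. Then there exists a continuous function R⁽⁰⁾ on the triangle {(x,t)∈ℝ²: 0≤t≤x≤b} such that for every ω∈ℂ the function u(x) := (√π Γ(l+1)/(2^{l+3/2} Γ(l+3/2)²)) · 𝐛_l(ω,x) + ∫_0^x R⁽⁰⁾(x,t) cos(ωt) dt is twice differentiable on (0,b] and satisfies −u″(x) + (l(l+1)/x² + q(x)) u(x) = ω² u(x) for all x∈(0,b]. -/

import Mathlib

open MeasureTheory Filter

/-- The function 𝐛_l(ω,x). -/
noncomputable def blFn (l : ℝ) (ω : ℂ) (x : ℝ) : ℂ :=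
  (Real.Gamma (l + 3/2) : ℂ) * (x:ℂ) ^ ((l:ℂ) + 1) *
    ∑' k : ℕ, (-1)^k * (ω * x)^(2*k) /
      ((2:ℂ)^(2*k) * (Real.Gamma (k+1) : ℂ) * (Real.Gamma (k + l + 3/2) : ℂ))

/-- The half-open rectangle with opposite corners `0` and `p`. -/
def originRect (p : ℝ × ℝ) : Set (ℝ × ℝ) := Set.Ioc 0 p.1 ×ˢ Set.Ioc 0 p.2

lemma measurableSet_originRect (p : ℝ × ℝ) : MeasurableSet (originRect p) :=
  measurableSet_Ioc.prod measurableSet_Ioc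

lemma volume_restrict_originRect (p : ℝ × ℝ) :
    (volume : Measure (ℝ × ℝ)).restrict (originRect p) =
      (volume.restrict (Set.Ioc 0 p.1)).prod (volume.restrict (Set.Ioc 0 p.2)) := by
  rw [Measure.prod_restrict]; rfl

lemma ae_prod_fst_ne_and_snd_ne (p : ℝ × ℝ) :
    ∀ᵐ z : ℝ × ℝ, z.1 ≠ p.1 ∧ z.2 ≠ p.2 := by
  have h1 : ∀ᵐ z : ℝ × ℝ, z.1 ≠ p.1 :=
    Measure.quasiMeasurePreserving_fst.ae (Measure.ae_ne volume p.1)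
  have h2 : ∀ᵐ z : ℝ × ℝ, z.2 ≠ p.2 :=
    Measure.quasiMeasurePreserving_snd.ae (Measure.ae_ne volume p.2)
  exact h1.and h2

lemma continuous_integral_originRect {G : ℝ × ℝ → ℂ}
    (hG : ∀ p, IntegrableOn G (originRect p)) :
    Continuous fun p => ∫ z in originRect p, G z := by
  rw [continuous_iff_continuousAt]
  intro p
  simp_rw [fun p => (integral_indicator (f := G) (μ := volume)
    (measurableSet_originRect p)).symm]
  set P : ℝ × ℝ := (p.1 + 1, p.2 + 1) with hP
  have hsub : ∀ᶠ r : ℝ × ℝ in nhds p, originRect r ⊆ originRect P := by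
    have h1 : ∀ᶠ r : ℝ × ℝ in nhds p, r.1 < p.1 + 1 :=
      continuous_fst.continuousAt.eventually_lt continuousAt_const (by simp)
    have h2 : ∀ᶠ r : ℝ × ℝ in nhds p, r.2 < p.2 + 1 :=
      continuous_snd.continuousAt.eventually_lt continuousAt_const (by simp)
    filter_upwards [h1, h2] with r h1 h2
    exact Set.prod_mono (Set.Ioc_subset_Ioc_right h1.le) (Set.Ioc_subset_Ioc_right h2.le)
  refine continuousAt_of_dominated (bound := fun z => ‖(originRect P).indicator G z‖)
    (.of_forall fun r => ?_) ?_ ?_ ?_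
  · exact ((integrable_indicator_iff (measurableSet_originRect r)).2 (hG r)).aestronglyMeasurable
  · filter_upwards [hsub] with r hr
    exact .of_forall fun z => norm_indicator_le_of_subset hr _ _
  · exact ((integrable_indicator_iff (measurableSet_originRect P)).2 (hG P)).norm
  · filter_upwards [ae_prod_fst_ne_and_snd_ne p] with z ⟨hz1, hz2⟩
    have key : ∀ᶠ r : ℝ × ℝ in nhds p, (z ∈ originRect r ↔ z ∈ originRect p) := by
      have h1 : ∀ᶠ r : ℝ × ℝ in nhds p, (z.1 ≤ r.1 ↔ z.1 ≤ p.1) := by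
        rcases lt_or_gt_of_ne hz1 with h | h
        · filter_upwards [continuousAt_const.eventually_lt continuous_fst.continuousAt h] with r hr
          exact iff_of_true hr.le h.le
        · filter_upwards [continuous_fst.continuousAt.eventually_lt continuousAt_const h] with r hr
          exact iff_of_false hr.not_ge h.not_ge
      have h2 : ∀ᶠ r : ℝ × ℝ in nhds p, (z.2 ≤ r.2 ↔ z.2 ≤ p.2) := by
        rcases lt_or_gt_of_ne hz2 with h | h
        · filter_upwards [continuousAt_const.eventually_lt continuous_snd.continuousAt h] with r hr
          exact iff_of_true hr.le h.le
        · filter_upwards [continuous_snd.continuousAt.eventually_lt continuousAt_const h] with r hr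
          exact iff_of_false hr.not_ge h.not_ge
      filter_upwards [h1, h2] with r h1 h2
      simp only [originRect, Set.mem_prod, Set.mem_Ioc, h1, h2]
    refine (continuousAt_const (y := (originRect p).indicator G z)).congr ?_
    filter_upwards [key] with r hr
    by_cases hz : z ∈ originRect p
    · rw [Set.indicator_of_mem hz, Set.indicator_of_mem (hr.2 hz)]
    · rw [Set.indicator_of_notMem hz, Set.indicator_of_notMem (mt hr.1 hz)]

lemma lintegral_Ioc_deriv_le {f f' : ℝ → ℝ} (hd : ∀ x, 0 < x → HasDerivAt f (f' x) x)
    (hc : ContinuousOn f' (Set.Ioi 0)) (hf : ∀ x, 0 < x → 0 ≤ f x)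
    (hf' : ∀ x, 0 < x → 0 ≤ f' x) {a c : ℝ} (ha : 0 < a) (h0c : 0 ≤ c) :
    ∫⁻ y in Set.Ioc 0 c, ENNReal.ofReal (f' (a + y)) ≤ ENNReal.ofReal (f (a + c)) := by
  have hcont : ContinuousOn (fun y => f' (a + y)) (Set.uIcc 0 c) := by
    refine hc.comp (by fun_prop) fun y hy => ?_
    rw [Set.uIcc_of_le h0c] at hy
    exact add_pos_of_pos_of_nonneg ha hy.1
  have hinteg := hcont.intervalIntegrable (μ := volume)
  rw [← ofReal_integral_eq_lintegral_ofReal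
      ((intervalIntegrable_iff_integrableOn_Ioc_of_le h0c).1 hinteg)
    ((ae_restrict_iff' measurableSet_Ioc).2 (.of_forall fun y hy => hf' _ (add_pos ha hy.1))),
    ← intervalIntegral.integral_of_le h0c,
    intervalIntegral.integral_eq_sub_of_hasDerivAt (f := fun y => f (a + y)) ?_ hinteg]
  · refine ENNReal.ofReal_le_ofReal ?_
    have := hf a ha
    simpa using this
  · intro y hy
    rw [Set.uIcc_of_le h0c] at hy
    exact (hd (a + y) (add_pos_of_pos_of_nonneg ha hy.1)).comp_const_add a y

lemma integral_originRect_secondDeriv_le {f f' f'' : ℝ → ℝ}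
    (hd : ∀ x, 0 < x → HasDerivAt f (f' x) x) (hd' : ∀ x, 0 < x → HasDerivAt f' (f'' x) x)
    (hc : ContinuousOn f'' (Set.Ioi 0)) (hm : Measurable f'') (hf : ∀ x, 0 ≤ x → 0 ≤ f x)
    (hf' : ∀ x, 0 < x → 0 ≤ f' x) (hf'' : ∀ x, 0 < x → 0 ≤ f'' x) (p : ℝ × ℝ) :
    IntegrableOn (fun z : ℝ × ℝ => f'' (z.1 + z.2)) (originRect p) ∧
      (0 ≤ p.1 → 0 ≤ p.2 → ∫ z in originRect p, f'' (z.1 + z.2) ≤ f (p.1 + p.2)) := by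
  have hpos : 0 ≤ᵐ[volume.restrict (originRect p)] fun z : ℝ × ℝ => f'' (z.1 + z.2) :=
    (ae_restrict_iff' (measurableSet_originRect p)).2
      (.of_forall fun z hz => hf'' _ (add_pos hz.1.1 hz.2.1))
  have hmz : Measurable fun z : ℝ × ℝ => f'' (z.1 + z.2) := by fun_prop
  by_cases hp : 0 < p.1 ∧ 0 < p.2
  · have hle : ∫⁻ z in originRect p, ENNReal.ofReal (f'' (z.1 + z.2)) ≤
        ENNReal.ofReal (f (p.1 + p.2)) := by
      rw [volume_restrict_originRect, lintegral_prod _ hmz.ennreal_ofReal.aemeasurable]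
      calc _ ≤ ∫⁻ x in Set.Ioc 0 p.1, ENNReal.ofReal (f' (p.2 + x)) := by
            refine setLIntegral_mono_ae' measurableSet_Ioc (.of_forall fun x hx => ?_)
            rw [add_comm p.2 x]
            exact lintegral_Ioc_deriv_le hd' hc hf' hf'' hx.1 hp.2.le
        _ ≤ _ := by
            rw [add_comm p.1 p.2]
            exact lintegral_Ioc_deriv_le hd
              (fun x hx => (hd' x hx).continuousAt.continuousWithinAt) (fun x hx => hf x hx.le) hf'
              hp.2 hp.1.le
    constructor
    · refine ⟨hmz.aestronglyMeasurable, ?_⟩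
      rw [hasFiniteIntegral_iff_ofReal hpos]
      exact hle.trans_lt ENNReal.ofReal_lt_top
    · intro _ _
      rw [integral_eq_lintegral_of_nonneg_ae hpos hmz.aestronglyMeasurable]
      exact ENNReal.toReal_le_of_le_ofReal (hf _ (add_pos hp.1 hp.2).le) hle
  · have he : originRect p = ∅ := by
      rw [originRect, Set.prod_eq_empty_iff, Set.Ioc_eq_empty_iff, Set.Ioc_eq_empty_iff]
      tauto
    rw [he]
    refine ⟨integrableOn_empty, fun h1 h2 => ?_⟩
    simpa using hf _ (add_nonneg h1 h2)

/-- The weight `x ^ d * exp (κ x)`. -/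
noncomputable def expWeight (d κ x : ℝ) : ℝ := x ^ d * Real.exp (κ * x)

/-- The derivative of `expWeight d κ`. -/
noncomputable def expWeight' (d κ x : ℝ) : ℝ :=
  (d * x ^ (d - 1) + κ * x ^ d) * Real.exp (κ * x)

/-- The second derivative of `expWeight d κ`. -/
noncomputable def expWeight'' (d κ x : ℝ) : ℝ :=
  (d * (d - 1) * x ^ (d - 2) + 2 * κ * d * x ^ (d - 1) + κ ^ 2 * x ^ d) * Real.exp (κ * x)

lemma hasDerivAt_expWeight (d κ : ℝ) {x : ℝ} (hx : 0 < x) :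
    HasDerivAt (expWeight d κ) (expWeight' d κ x) x := by
  have h1 := Real.hasDerivAt_rpow_const (p := d) (Or.inl hx.ne')
  have h2 : HasDerivAt (fun x => Real.exp (κ * x)) (Real.exp (κ * x) * (κ * 1)) x :=
    ((hasDerivAt_id x).const_mul κ).exp
  refine (h1.mul h2).congr_deriv ?_
  rw [expWeight']; ring

lemma hasDerivAt_expWeight' (d κ : ℝ) {x : ℝ} (hx : 0 < x) :
    HasDerivAt (expWeight' d κ) (expWeight'' d κ x) x := by
  have h1 := Real.hasDerivAt_rpow_const (p := d) (Or.inl hx.ne')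
  have h1' := Real.hasDerivAt_rpow_const (p := d - 1) (Or.inl hx.ne')
  have h2 : HasDerivAt (fun x => Real.exp (κ * x)) (Real.exp (κ * x) * (κ * 1)) x :=
    ((hasDerivAt_id x).const_mul κ).exp
  refine (((h1'.const_mul d).add (h1.const_mul κ)).mul h2).congr_deriv ?_
  rw [expWeight'', show d - 1 - 1 = d - 2 by ring]; simp only [Pi.add_apply]; ring

lemma expWeight_nonneg (d κ : ℝ) {x : ℝ} (hx : 0 ≤ x) : 0 ≤ expWeight d κ x :=
  mul_nonneg (Real.rpow_nonneg hx _) (Real.exp_pos _).le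

lemma measurable_expWeight'' (d κ : ℝ) : Measurable (expWeight'' d κ) := by
  unfold expWeight''; fun_prop

lemma expWeight''_nonneg {d κ : ℝ} (hd : 1 ≤ d) (hκ : 0 ≤ κ) {x : ℝ} (hx : 0 < x) :
    0 ≤ expWeight'' d κ x := by
  have : 0 ≤ d - 1 := by linarith
  unfold expWeight''; positivity

lemma integral_originRect_expWeight''_le {d κ : ℝ} (hd : 1 ≤ d) (hκ : 0 ≤ κ) (p : ℝ × ℝ) :
    IntegrableOn (fun z : ℝ × ℝ => expWeight'' d κ (z.1 + z.2)) (originRect p) ∧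
      (0 ≤ p.1 → 0 ≤ p.2 →
        ∫ z in originRect p, expWeight'' d κ (z.1 + z.2) ≤ expWeight d κ (p.1 + p.2)) := by
  refine integral_originRect_secondDeriv_le (fun x hx => hasDerivAt_expWeight d κ hx)
    (fun x hx => hasDerivAt_expWeight' d κ hx) ?_ (measurable_expWeight'' d κ)
    (fun x hx => expWeight_nonneg d κ hx) (fun x hx => ?_)
    (fun x hx => expWeight''_nonneg hd hκ hx) p
  · intro x hx
    have hx' : x ≠ 0 := (Set.mem_Ioi.1 hx).ne'
    refine ContinuousAt.continuousWithinAt ?_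
    unfold expWeight''
    have h : ∀ s : ℝ, ContinuousAt (fun x : ℝ => x ^ s) x :=
      fun s => Real.continuousAt_rpow_const x s (Or.inl hx')
    have := h d
    have := h (d - 1)
    have := h (d - 2)
    fun_prop
  · unfold expWeight'; positivity

/-- The weight absorbs the singular potential with a contraction factor. -/
lemma mul_expWeight_le {l κ M θ : ℝ} (hl : -1 < l) (hκ : 0 ≤ κ)
    (h1 : |l| ≤ θ * (l + 2)) (h2 : M ≤ θ * κ ^ 2) (hθ : 0 ≤ θ) {x : ℝ} (hx : 0 < x) :
    (|l * (l + 1)| / x ^ 2 + M) * expWeight (l + 2) κ x ≤ θ * expWeight'' (l + 2) κ x := by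
  have hxl : x ^ (l + 2) = x ^ l * x ^ 2 := by
    rw [Real.rpow_add hx]; norm_cast
  have hxl1 : x ^ (l + 2 - 1) = x ^ l * x := by
    rw [show l + 2 - 1 = l + 1 by ring, Real.rpow_add hx, Real.rpow_one]
  have hxl2 : x ^ (l + 2 - 2) = x ^ l := by rw [show l + 2 - 2 = l by ring]
  unfold expWeight expWeight''
  rw [hxl, hxl1, hxl2, abs_mul, abs_of_pos (show 0 < l + 1 by linarith)]
  have hp : 0 < x ^ l := Real.rpow_pos_of_pos hx l
  have : (|l| * (l + 1) / x ^ 2 + M) * (x ^ l * x ^ 2 * Real.exp (κ * x)) =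
      (|l| * (l + 1) + M * x ^ 2) * (x ^ l * Real.exp (κ * x)) := by
    field_simp
  rw [this]
  have h3 : |l| * (l + 1) + M * x ^ 2 ≤
      θ * ((l + 2) * (l + 1) + 2 * κ * (l + 2) * x + κ ^ 2 * x ^ 2) := by
    have e1 : |l| * (l + 1) ≤ θ * (l + 2) * (l + 1) :=
      mul_le_mul_of_nonneg_right h1 (by linarith)
    have e2 : M * x ^ 2 ≤ θ * κ ^ 2 * x ^ 2 := mul_le_mul_of_nonneg_right h2 (by positivity)
    have : 0 < l + 2 := by linarith
    have e3 : 0 ≤ θ * (2 * κ * (l + 2) * x) := by positivity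
    nlinarith
  calc _ ≤ _ := mul_le_mul_of_nonneg_right h3 (mul_nonneg hp.le (Real.exp_pos _).le)
    _ = _ := by ring

lemma originRect_eq_empty {p : ℝ × ℝ} (hp : ¬(0 ≤ p.1 ∧ 0 ≤ p.2)) : originRect p = ∅ := by
  rw [originRect, Set.prod_eq_empty_iff, Set.Ioc_eq_empty_iff, Set.Ioc_eq_empty_iff]
  by_contra! h
  exact hp ⟨h.1.le, h.2.le⟩

/-- Picard iterates of the Goursat problem `∂ξ ∂η R = F₀ + V R` with zero data on the axes. -/
noncomputable def goursatIter (V F₀ : ℝ × ℝ → ℂ) : ℕ → ℝ × ℝ → ℂ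
  | 0 => fun p => ∫ z in originRect p, F₀ z
  | n + 1 => fun p => ∫ z in originRect p, V z * goursatIter V F₀ n z

/-- The Goursat problem with a singular potential `V` is solvable if there is a weight `w` on which
the integral operator with kernel `‖V‖` is a contraction. -/
theorem exists_goursat_solution {V F₀ : ℝ × ℝ → ℂ} (hV : Measurable V)
    (hF₀ : ∀ p, IntegrableOn F₀ (originRect p)) {w w'' : ℝ × ℝ → ℝ} {θ K : ℝ}
    (hθ : 0 ≤ θ) (hθ1 : θ < 1) (hK : 0 ≤ K)
    (hwi : ∀ p, IntegrableOn w'' (originRect p))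
    (hw : ∀ p : ℝ × ℝ, 0 ≤ p.1 → 0 ≤ p.2 → ∫ z in originRect p, w'' z ≤ w p)
    (hVw : ∀ p : ℝ × ℝ, 0 < p.1 → 0 < p.2 → ‖V p‖ * w p ≤ θ * w'' p)
    (hF₀w : ∀ p : ℝ × ℝ, 0 ≤ p.1 → 0 ≤ p.2 → ‖∫ z in originRect p, F₀ z‖ ≤ K * w p) :
    ∃ R : ℝ × ℝ → ℂ, Continuous R ∧
      (∀ p, IntegrableOn (fun z => F₀ z + V z * R z) (originRect p)) ∧
      ∀ p, R p = ∫ z in originRect p, (F₀ z + V z * R z) := by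
  set r := goursatIter V F₀ with hr
  have hstep : ∀ n, Continuous (r n) →
      (∀ p : ℝ × ℝ, 0 ≤ p.1 → 0 ≤ p.2 → ‖r n p‖ ≤ K * θ ^ n * w p) →
      ∀ z : ℝ × ℝ, 0 < z.1 → 0 < z.2 → ‖V z * r n z‖ ≤ K * θ ^ (n + 1) * w'' z := by
    intro n _ hb z hz1 hz2
    rw [norm_mul]
    calc ‖V z‖ * ‖r n z‖ ≤ ‖V z‖ * (K * θ ^ n * w z) :=
          mul_le_mul_of_nonneg_left (hb z hz1.le hz2.le) (norm_nonneg _)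
      _ = K * θ ^ n * (‖V z‖ * w z) := by ring
      _ ≤ K * θ ^ n * (θ * w'' z) := mul_le_mul_of_nonneg_left (hVw z hz1 hz2) (by positivity)
      _ = _ := by ring
  have hae : ∀ n, (∀ z : ℝ × ℝ, 0 < z.1 → 0 < z.2 → ‖V z * r n z‖ ≤ K * θ ^ (n + 1) * w'' z) →
      ∀ p, ∀ᵐ z ∂volume.restrict (originRect p), ‖V z * r n z‖ ≤ K * θ ^ (n + 1) * w'' z :=
    fun n h p => (ae_restrict_iff' (measurableSet_originRect p)).2
      (.of_forall fun z hz => h z hz.1.1 hz.2.1)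
  have hinteg : ∀ n, Continuous (r n) →
      (∀ z : ℝ × ℝ, 0 < z.1 → 0 < z.2 → ‖V z * r n z‖ ≤ K * θ ^ (n + 1) * w'' z) →
      ∀ p, IntegrableOn (fun z => V z * r n z) (originRect p) := by
    intro n hc h p
    exact Integrable.mono' ((hwi p).const_mul _)
      (hV.mul hc.measurable).aestronglyMeasurable (hae n h p)
  have main : ∀ n, Continuous (r n) ∧
      ∀ p : ℝ × ℝ, 0 ≤ p.1 → 0 ≤ p.2 → ‖r n p‖ ≤ K * θ ^ n * w p := by
    intro n
    induction n with
    | zero =>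
      refine ⟨continuous_integral_originRect hF₀, fun p h1 h2 => ?_⟩
      simpa [hr, goursatIter] using hF₀w p h1 h2
    | succ n ih =>
      have h := hstep n ih.1 ih.2
      refine ⟨continuous_integral_originRect (hinteg n ih.1 h), fun p h1 h2 => ?_⟩
      refine (norm_integral_le_of_norm_le ((hwi p).const_mul _) (hae n h p)).trans ?_
      rw [integral_const_mul]
      exact mul_le_mul_of_nonneg_left (hw p h1 h2) (by positivity)
  have hb := fun n => hstep n (main n).1 (main n).2
  have hrinteg := fun n => hinteg n (main n).1 (hb n)
  have hgeom : Summable fun n : ℕ => θ ^ n := summable_geometric_of_lt_one hθ hθ1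
  have hsum : ∀ p, Summable fun n => r n p := by
    intro p
    by_cases hp : 0 ≤ p.1 ∧ 0 ≤ p.2
    · exact Summable.of_norm_bounded ((hgeom.mul_left K).mul_right (w p))
        fun n => (main n).2 p hp.1 hp.2
    · have : ∀ n, r n p = 0 := by
        rintro (_ | n) <;> simp [hr, goursatIter, originRect_eq_empty hp]
      simp [this, summable_zero]
  set R : ℝ × ℝ → ℂ := fun p => ∑' n, r n p with hR
  have hRm : Measurable R := by
    refine measurable_of_tendsto_metrizable
      (f := fun N p => ∑ n ∈ Finset.range N, r n p)
      (fun N => Finset.measurable_fun_sum _ fun n _ => (main n).1.measurable) ?_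
    exact tendsto_pi_nhds.2 fun p => (hsum p).hasSum.tendsto_sum_nat
  have hVR : ∀ z, V z * R z = ∑' n, V z * r n z := fun z => ((hsum z).tsum_mul_left _).symm
  have hVRi : ∀ p, IntegrableOn (fun z => V z * R z) (originRect p) := by
    intro p
    refine Integrable.mono' ((hwi p).const_mul (∑' n : ℕ, K * θ ^ (n + 1)))
      (hV.mul hRm).aestronglyMeasurable ((ae_restrict_iff' (measurableSet_originRect p)).2
      (.of_forall fun z hz => ?_))
    have hs : Summable fun n : ℕ => K * θ ^ (n + 1) :=
      ((summable_nat_add_iff 1).2 hgeom).mul_left K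
    rw [hVR, ← tsum_mul_right]
    exact tsum_of_norm_bounded (hs.mul_right _).hasSum fun n => hb n z hz.1.1 hz.2.1
  have hFi : ∀ p, IntegrableOn (fun z => F₀ z + V z * R z) (originRect p) :=
    fun p => (hF₀ p).add (hVRi p)
  have hfix : ∀ p, R p = ∫ z in originRect p, (F₀ z + V z * R z) := by
    intro p
    rw [integral_add (hF₀ p) (hVRi p)]
    have hs : Summable fun n => ∫ z in originRect p, ‖V z * r n z‖ := by
      refine Summable.of_nonneg_of_le (fun n => integral_nonneg fun z => norm_nonneg _)
        (f := fun n => K * θ ^ (n + 1) * ∫ z in originRect p, w'' z) (fun n => ?_)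
        ((((summable_nat_add_iff 1).2 hgeom).mul_left K).mul_right _)
      rw [← integral_const_mul]
      exact integral_mono_ae (hrinteg n p).norm ((hwi p).const_mul _) (hae n (hb n) p)
    have h := hasSum_integral_of_summable_integral_norm (fun n => hrinteg n p) hs
    simp_rw [← hVR] at h
    rw [← h.tsum_eq, hR]
    simp only
    rw [(hsum p).tsum_eq_zero_add]
    rfl
  refine ⟨R, ?_, hFi, hfix⟩
  rw [funext hfix]
  exact continuous_integral_originRect hFi

lemma rpow_mul_div_add_le {l a c : ℝ} (hl : -1 ≤ l) (ha : 0 < a) (hc : 0 < c) :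
    (a * c / (a + c)) ^ l ≤ a ^ l + c ^ l := by
  rcases le_or_gt 0 l with h | h
  · have : a * c / (a + c) ≤ a := by
      rw [div_le_iff₀ (by positivity)]; nlinarith
    exact (Real.rpow_le_rpow (by positivity) this h).trans
      (le_add_of_nonneg_right (Real.rpow_nonneg hc.le _))
  · have e : a * c / (a + c) = (a⁻¹ + c⁻¹)⁻¹ := by field_simp; ring
    rw [e, Real.inv_rpow (by positivity), ← Real.rpow_neg (by positivity)]
    have := Real.rpow_add_le_add_rpow (p := -l) (inv_nonneg.2 ha.le) (inv_nonneg.2 hc.le)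
      (by linarith) (by linarith)
    rwa [Real.inv_rpow ha.le, Real.inv_rpow hc.le, Real.rpow_neg ha.le, Real.rpow_neg hc.le,
      inv_inv, inv_inv] at this

lemma integrableOn_Ioc_rpow {l : ℝ} (hl : -1 < l) (c : ℝ) :
    IntegrableOn (fun x : ℝ => x ^ l) (Set.Ioc 0 c) := by
  rcases le_total 0 c with h | h
  · exact (intervalIntegrable_iff_integrableOn_Ioc_of_le h).1
      (intervalIntegral.intervalIntegrable_rpow' hl)
  · rw [Set.Ioc_eq_empty_of_le h]; exact integrableOn_empty

lemma integral_originRect_rpow_add_rpow_le {l : ℝ} (hl : -1 < l) (p : ℝ × ℝ) :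
    IntegrableOn (fun z : ℝ × ℝ => z.1 ^ l + z.2 ^ l) (originRect p) ∧
      (0 ≤ p.1 → 0 ≤ p.2 → ∫ z in originRect p, (z.1 ^ l + z.2 ^ l) ≤
        2 / (l + 1) * (p.1 + p.2) ^ (l + 2)) := by
  have hone : ∀ c : ℝ, IntegrableOn (fun _ : ℝ => (1 : ℝ)) (Set.Ioc 0 c) := fun c => by simp
  have h1 : IntegrableOn (fun z : ℝ × ℝ => z.1 ^ l) (originRect p) := by
    rw [IntegrableOn, volume_restrict_originRect]
    simpa using (integrableOn_Ioc_rpow hl p.1).mul_prod (hone p.2)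
  have h2 : IntegrableOn (fun z : ℝ × ℝ => z.2 ^ l) (originRect p) := by
    rw [IntegrableOn, volume_restrict_originRect]
    simpa using (hone p.1).mul_prod (integrableOn_Ioc_rpow hl p.2)
  refine ⟨h1.add h2, fun hp1 hp2 => ?_⟩
  have hl1 : 0 < l + 1 := by linarith
  have hI : ∀ c : ℝ, 0 ≤ c → ∫ x in Set.Ioc 0 c, x ^ l = c ^ (l + 1) / (l + 1) := by
    intro c hc
    rw [← intervalIntegral.integral_of_le hc, integral_rpow (Or.inl hl),
      Real.zero_rpow hl1.ne', sub_zero]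
  have e1 : ∫ z in originRect p, z.1 ^ l = p.1 ^ (l + 1) / (l + 1) * p.2 := by
    rw [volume_restrict_originRect]
    have := integral_prod_mul (μ := volume.restrict (Set.Ioc 0 p.1))
      (ν := volume.restrict (Set.Ioc 0 p.2)) (fun x : ℝ => x ^ l) (fun _ : ℝ => (1 : ℝ))
    simpa [hI p.1 hp1, hp2] using this
  have e2 : ∫ z in originRect p, z.2 ^ l = p.1 * (p.2 ^ (l + 1) / (l + 1)) := by
    rw [volume_restrict_originRect]
    have := integral_prod_mul (μ := volume.restrict (Set.Ioc 0 p.1))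
      (ν := volume.restrict (Set.Ioc 0 p.2)) (fun _ : ℝ => (1 : ℝ)) (fun x : ℝ => x ^ l)
    simpa [hI p.2 hp2, hp1] using this
  rw [integral_add h1 h2, e1, e2]
  set s := p.1 + p.2
  have hs : 0 ≤ s := add_nonneg hp1 hp2
  have k : ∀ x y : ℝ, 0 ≤ x → 0 ≤ y → x ≤ s → y ≤ s → x ^ (l + 1) * y ≤ s ^ (l + 2) := by
    intro x y hx hy hxs hys
    rw [show l + 2 = l + 1 + 1 by ring, Real.rpow_add_one' hs (by linarith)]
    exact mul_le_mul (Real.rpow_le_rpow hx hxs hl1.le) hys hy (Real.rpow_nonneg hs _)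
  have k1 := k p.1 p.2 hp1 hp2 (le_add_of_nonneg_right hp2) (le_add_of_nonneg_left hp1)
  have k2 := k p.2 p.1 hp2 hp1 (le_add_of_nonneg_left hp1) (le_add_of_nonneg_right hp2)
  calc _ = (p.1 ^ (l + 1) * p.2 + p.2 ^ (l + 1) * p.1) / (l + 1) := by ring
    _ ≤ (s ^ (l + 2) + s ^ (l + 2)) / (l + 1) :=
        div_le_div_of_nonneg_right (add_le_add k1 k2) hl1.le
    _ = _ := by ring

/-- The kernel of the Poisson integral for the unperturbed equation, in characteristic
coordinates. -/
noncomputable def besselKernel (l : ℝ) (z : ℝ × ℝ) : ℝ := (z.1 * z.2 / (z.1 + z.2)) ^ l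

lemma measurable_besselKernel (l : ℝ) : Measurable (besselKernel l) := by
  unfold besselKernel; fun_prop

/-- The potential of the perturbed Bessel equation, in characteristic coordinates. -/
noncomputable def besselPotential (l : ℝ) (Q : ℝ → ℂ) (x : ℝ) : ℂ :=
  ((l * (l + 1) / x ^ 2 : ℝ) : ℂ) + Q x

theorem exists_bessel_goursat_solution {l : ℝ} (hl : -(1 / 2) ≤ l) {Q : ℝ → ℂ}
    (hQ : Continuous Q) {M : ℝ} (hM : ∀ x, ‖Q x‖ ≤ M) :
    ∃ R : ℝ × ℝ → ℂ, Continuous R ∧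
      (∀ p, IntegrableOn (fun z : ℝ × ℝ => Q (z.1 + z.2) * besselKernel l z +
        besselPotential l Q (z.1 + z.2) * R z) (originRect p)) ∧
      ∀ p, R p = ∫ z in originRect p, (Q (z.1 + z.2) * besselKernel l z +
        besselPotential l Q (z.1 + z.2) * R z) := by
  have hl1 : -1 < l := by linarith
  have hM0 : 0 ≤ M := (norm_nonneg _).trans (hM 0)
  set θ : ℝ := (|l| + 1 / 4) / (l + 2) with hθdef
  have hl2 : 0 < l + 2 := by linarith
  have hθ : 0 < θ := by positivity
  have hθ1 : θ < 1 := by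
    rw [hθdef, div_lt_one hl2]
    rcases abs_cases l with h | h <;> linarith
  have habs : |l| ≤ θ * (l + 2) := by
    rw [hθdef, div_mul_cancel₀ _ hl2.ne']; linarith
  set κ : ℝ := Real.sqrt (M / θ) with hκdef
  have hκ : 0 ≤ κ := Real.sqrt_nonneg _
  have hκ2 : M ≤ θ * κ ^ 2 := by
    rw [hκdef, Real.sq_sqrt (by positivity), mul_div_cancel₀ _ hθ.ne']
  have hVm : Measurable fun z : ℝ × ℝ => besselPotential l Q (z.1 + z.2) := by
    unfold besselPotential
    have := hQ.measurable
    fun_prop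
  have hae : ∀ p, ∀ᵐ z : ℝ × ℝ ∂volume.restrict (originRect p),
      ‖Q (z.1 + z.2) * besselKernel l z‖ ≤ M * (z.1 ^ l + z.2 ^ l) := fun p =>
    (ae_restrict_iff' (measurableSet_originRect p)).2 <| .of_forall fun z hz => by
      have hz1 : 0 < z.1 := hz.1.1
      have hz2 : 0 < z.2 := hz.2.1
      rw [norm_mul, Complex.norm_real, besselKernel,
        Real.norm_of_nonneg (Real.rpow_nonneg (by positivity) _)]
      exact mul_le_mul (hM _) (rpow_mul_div_add_le hl1.le hz1 hz2)
        (Real.rpow_nonneg (by positivity) _) hM0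
  have hsrc := fun p => integral_originRect_rpow_add_rpow_le hl1 p
  refine exists_goursat_solution hVm (w := fun z => expWeight (l + 2) κ (z.1 + z.2))
    (w'' := fun z => expWeight'' (l + 2) κ (z.1 + z.2)) (K := M * (2 / (l + 1)))
    ?_ hθ.le hθ1 ?_ ?_ ?_ ?_ ?_
  · intro p
    refine Integrable.mono' ((hsrc p).1.const_mul M) ?_ (hae p)
    have := hQ.measurable
    have := measurable_besselKernel l
    exact Measurable.aestronglyMeasurable (by fun_prop)
  · have : 0 < l + 1 := by linarith
    positivity
  · exact fun p => (integral_originRect_expWeight''_le (by linarith) hκ p).1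
  · exact fun p => (integral_originRect_expWeight''_le (by linarith) hκ p).2
  · intro p h1 h2
    have hx : 0 < p.1 + p.2 := add_pos h1 h2
    refine le_trans (mul_le_mul_of_nonneg_right ?_ (expWeight_nonneg _ _ hx.le))
      (mul_expWeight_le hl1 hκ habs hκ2 hθ.le hx)
    refine (norm_add_le _ _).trans (add_le_add ?_ (hM _))
    rw [Complex.norm_real, Real.norm_eq_abs, abs_div, abs_of_nonneg (sq_nonneg (p.1 + p.2))]
  · intro p h1 h2
    refine (norm_integral_le_of_norm_le ((hsrc p).1.const_mul M) (hae p)).trans ?_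
    rw [integral_const_mul, mul_assoc]
    refine mul_le_mul_of_nonneg_left (((hsrc p).2 h1 h2).trans ?_) hM0
    have hx : 0 ≤ p.1 + p.2 := add_nonneg h1 h2
    refine mul_le_mul_of_nonneg_left ?_ (div_nonneg zero_le_two (by linarith))
    exact le_mul_of_one_le_right (Real.rpow_nonneg hx _) (Real.one_le_exp (by positivity))

/-- The triangle cut off from the positive quadrant by the line `ξ + η = x`. -/
def originTriangle (x : ℝ) : Set (ℝ × ℝ) := {z | 0 < z.1 ∧ 0 < z.2 ∧ z.1 + z.2 ≤ x}

lemma measurableSet_originTriangle (x : ℝ) : MeasurableSet (originTriangle x) := by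
  unfold originTriangle; measurability

lemma originTriangle_subset (x : ℝ) : originTriangle x ⊆ originRect (x, x) := by
  rintro z ⟨h1, h2, h3⟩
  exact ⟨⟨h1, by simp only; linarith⟩, ⟨h2, by simp only; linarith⟩⟩

lemma integral_originTriangle {G : ℝ × ℝ → ℂ} {x : ℝ} (hx : 0 ≤ x)
    (hG : IntegrableOn G (originTriangle x)) :
    IntervalIntegrable (fun s => ∫ a in (0 : ℝ)..s, G (a, s - a)) volume 0 x ∧
      ∫ z in originTriangle x, G z = ∫ s in (0 : ℝ)..x, ∫ a in (0 : ℝ)..s, G (a, s - a) := by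
  set k : ℝ × ℝ → ℂ := fun z => (originTriangle x).indicator G (z.1, z.2 - z.1) with hk
  set e := MeasurableEquiv.shearAddRight ℝ
  have he : MeasurePreserving e (volume : Measure (ℝ × ℝ)) volume :=
    measurePreserving_prod_add volume volume
  have hke : k ∘ e = (originTriangle x).indicator G := by
    funext z
    change (originTriangle x).indicator G (z.1, z.1 + z.2 - z.1) = _
    rw [add_sub_cancel_left]
  have hki : Integrable k := by
    rw [← he.integrable_comp_emb e.measurableEmbedding, hke]
    exact hG.integrable_indicator (measurableSet_originTriangle x)
  have hfib : ∀ s, ∫ a, k (a, s) =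
      (Set.Ioc 0 x).indicator (fun s => ∫ a in (0 : ℝ)..s, G (a, s - a)) s := by
    intro s
    by_cases hs : s ∈ Set.Ioc 0 x
    · rw [Set.indicator_of_mem hs, intervalIntegral.integral_of_le hs.1.le,
        integral_Ioc_eq_integral_Ioo, ← integral_indicator measurableSet_Ioo]
      refine integral_congr_ae (.of_forall fun a => ?_)
      by_cases ha : a ∈ Set.Ioo 0 s
      · rw [Set.indicator_of_mem ha]
        exact Set.indicator_of_mem (s := originTriangle x)
          ⟨ha.1, by simpa using ha.2, by simpa using hs.2⟩ G
      · rw [Set.indicator_of_notMem ha]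
        refine Set.indicator_of_notMem (s := originTriangle x) ?_ G
        rintro ⟨h1, h2, -⟩
        exact ha ⟨h1, by simpa using h2⟩
    · rw [Set.indicator_of_notMem hs]
      refine integral_eq_zero_of_ae (.of_forall fun a => ?_)
      refine Set.indicator_of_notMem (s := originTriangle x) ?_ G
      rintro ⟨h1, h2, h3⟩
      simp only at h1 h2 h3
      exact hs ⟨by linarith, by linarith⟩
  constructor
  · rw [intervalIntegrable_iff_integrableOn_Ioc_of_le hx,
      ← integrable_indicator_iff measurableSet_Ioc, ← funext hfib]
    exact Integrable.integral_prod_right hki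
  · rw [← integral_indicator (measurableSet_originTriangle x), ← hke]
    simp only [Function.comp_apply]
    rw [he.integral_comp e.measurableEmbedding k, Measure.volume_eq_prod,
      integral_prod_symm _ hki, funext hfib, integral_indicator measurableSet_Ioc,
      intervalIntegral.integral_of_le hx]

/-- The solution of `y'' + ω² y = 0` with `y(0) = 0` and `y'(0) = 1`. -/
noncomputable def sincMul (ω : ℂ) (r : ℝ) : ℂ := ∫ ρ in (0 : ℝ)..r, Complex.cos (ω * ρ)

lemma hasDerivAt_sincMul (ω : ℂ) (r : ℝ) :
    HasDerivAt (sincMul ω) (Complex.cos (ω * r)) r :=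
  intervalIntegral.integral_hasDerivAt_right
    (Continuous.intervalIntegrable (by fun_prop) _ _)
    (Continuous.stronglyMeasurableAtFilter (by fun_prop) _ _)
    (Continuous.continuousAt (by fun_prop))

lemma mul_sincMul (ω : ℂ) (r : ℝ) : ω * sincMul ω r = Complex.sin (ω * r) := by
  rw [sincMul, ← intervalIntegral.integral_const_mul,
    intervalIntegral.integral_eq_sub_of_hasDerivAt (f := fun ρ : ℝ => Complex.sin (ω * ρ)) ?_
    (Continuous.intervalIntegrable (by fun_prop) _ _)]
  · simp
  · intro ρ _
    have h : HasDerivAt (fun ρ : ℝ => ω * (ρ : ℂ)) (ω * 1) ρ :=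
      (Complex.ofRealCLM.hasDerivAt (x := ρ)).const_mul ω
    exact ((Complex.hasDerivAt_sin _).comp ρ h).congr_deriv (by ring)

lemma sincMul_sub (ω : ℂ) (x s : ℝ) :
    sincMul ω (x - s) = sincMul ω x * Complex.cos (ω * s) - Complex.cos (ω * x) * sincMul ω s := by
  by_cases h : ω = 0
  · simp [h, sincMul]
  · refine mul_left_cancel₀ h ?_
    rw [mul_sub, mul_left_comm ω (Complex.cos _), ← mul_assoc, mul_sincMul, mul_sincMul,
      mul_sincMul]
    push_cast
    rw [mul_sub, Complex.sin_sub]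

lemma integral_cos_two_mul_sub (ω : ℂ) (x a c : ℝ) :
    ∫ ξ in a..(x - c), Complex.cos (ω * ((2 * ξ - x : ℝ) : ℂ)) =
      Complex.cos (ω * ((a - c : ℝ) : ℂ)) * sincMul ω (x - (a + c)) := by
  by_cases h : ω = 0
  · simp only [h, sincMul, zero_mul, Complex.cos_zero, intervalIntegral.integral_const, sub_zero,
      one_mul, Complex.real_smul, mul_one]
    congr 1; ring
  · refine mul_left_cancel₀ h ?_
    rw [mul_left_comm, mul_sincMul, ← intervalIntegral.integral_const_mul,
      intervalIntegral.integral_eq_sub_of_hasDerivAt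
        (f := fun ξ : ℝ => Complex.sin (ω * ((2 * ξ - x : ℝ) : ℂ)) / 2) ?_
        (Continuous.intervalIntegrable (by fun_prop) _ _)]
    · have e1 : ω * ((2 * (x - c) - x : ℝ) : ℂ) =
          ω * ((x - (a + c) : ℝ) : ℂ) + ω * ((a - c : ℝ) : ℂ) := by push_cast; ring
      have e2 : ω * ((2 * a - x : ℝ) : ℂ) =
          ω * ((a - c : ℝ) : ℂ) - ω * ((x - (a + c) : ℝ) : ℂ) := by push_cast; ring
      rw [e1, e2, Complex.sin_add, Complex.sin_sub]
      ring
    · intro ξ _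
      have h2 : HasDerivAt (fun ξ : ℝ => 2 * ξ - x) 2 ξ := by
        simpa using ((hasDerivAt_id ξ).const_mul 2).sub_const x
      have h1 : HasDerivAt (fun ξ : ℝ => ω * ((2 * ξ - x : ℝ) : ℂ)) (ω * ((2 : ℝ) : ℂ)) ξ :=
        h2.ofReal_comp.const_mul ω
      refine (((Complex.hasDerivAt_sin _).comp ξ h1).div_const 2).congr_deriv ?_
      push_cast; ring

/-- The Fourier cosine transform along the line `ξ + η = x`, in characteristic coordinates. -/
noncomputable def charCos (ω : ℂ) (G : ℝ × ℝ → ℂ) (x : ℝ) : ℂ :=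
  ∫ ξ in (0 : ℝ)..x, G (ξ, x - ξ) * Complex.cos (ω * ((2 * ξ - x : ℝ) : ℂ))

/-- Integration over characteristic rectangles becomes Duhamel's integral under the cosine
transform. -/
theorem charCos_integral_originRect {F : ℝ × ℝ → ℂ} (hF : ∀ p, IntegrableOn F (originRect p))
    (ω : ℂ) {x : ℝ} (hx : 0 ≤ x) :
    IntervalIntegrable (charCos ω F) volume 0 x ∧
      charCos ω (fun p => ∫ z in originRect p, F z) x =
        ∫ s in (0 : ℝ)..x, sincMul ω (x - s) * charCos ω F s := by
  have hFT : ∀ φ : ℝ × ℝ → ℂ, Continuous φ →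
      IntegrableOn (fun z => F z * φ z) (originTriangle x) := by
    intro φ hφ
    refine IntegrableOn.mul_continuousOn_of_subset ((hF (x, x)).mono_set (originTriangle_subset x))
      hφ.continuousOn (measurableSet_originTriangle x)
      (K := Set.Icc 0 x ×ˢ Set.Icc 0 x) (isCompact_Icc.prod isCompact_Icc) ?_
    exact (originTriangle_subset x).trans
      (Set.prod_mono Set.Ioc_subset_Icc_self Set.Ioc_subset_Icc_self)
  have hS : Continuous (sincMul ω) :=
    continuous_iff_continuousAt.2 fun r => (hasDerivAt_sincMul ω r).continuousAt
  have hcos : ∀ s, ∫ a in (0 : ℝ)..s,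
      F (a, s - a) * Complex.cos (ω * ((a - (s - a) : ℝ) : ℂ)) = charCos ω F s := by
    intro s
    refine intervalIntegral.integral_congr fun a _ => ?_
    congr 4; ring
  constructor
  · have h := (integral_originTriangle hx
      (hFT (fun z => Complex.cos (ω * ((z.1 - z.2 : ℝ) : ℂ))) (by fun_prop))).1
    simpa only [hcos] using h
  set g : ℝ → ℝ × ℝ → ℂ := fun ξ z => {w : ℝ × ℝ × ℝ | w.2.1 ≤ w.1 ∧ w.2.2 ≤ x - w.1}.indicator
    (fun w : ℝ × ℝ × ℝ => Complex.cos (ω * ((2 * w.1 - x : ℝ) : ℂ)) * F w.2) (ξ, z) with hg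
  have hgi : Integrable (Function.uncurry g)
      ((volume.restrict (Set.Ioc 0 x)).prod (volume.restrict (originRect (x, x)))) := by
    have hc : IntegrableOn (fun ξ : ℝ => Complex.cos (ω * ((2 * ξ - x : ℝ) : ℂ)))
        (Set.Ioc 0 x) :=
      (Continuous.integrableOn_Icc (by fun_prop)).mono_set Set.Ioc_subset_Icc_self
    exact (hc.mul_prod (hF (x, x))).indicator (by measurability)
  have hleft : charCos ω (fun p => ∫ z in originRect p, F z) x =
      ∫ ξ in Set.Ioc 0 x, ∫ z in originRect (x, x), g ξ z := by
    rw [charCos, intervalIntegral.integral_of_le hx]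
    refine setIntegral_congr_fun measurableSet_Ioc fun ξ hξ => ?_
    rw [mul_comm, ← integral_const_mul, ← integral_indicator (measurableSet_originRect _),
      ← integral_indicator (measurableSet_originRect _)]
    congr 1
    funext z
    have hmem : z ∈ originRect (ξ, x - ξ) ↔ z ∈ originRect (x, x) ∧ z.1 ≤ ξ ∧ z.2 ≤ x - ξ := by
      simp only [originRect, Set.mem_prod, Set.mem_Ioc]
      constructor
      · rintro ⟨⟨h1, h2⟩, h3, h4⟩
        exact ⟨⟨⟨h1, h2.trans hξ.2⟩, h3, by linarith [hξ.1]⟩, h2, h4⟩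
      · rintro ⟨⟨⟨h1, _⟩, h3, _⟩, h2, h4⟩
        exact ⟨⟨h1, h2⟩, h3, h4⟩
    classical
    simp only [hg, Set.indicator_apply, hmem, Set.mem_ofPred_eq]
    split_ifs <;> first | rfl | (exfalso; tauto)
  have hinner : ∀ z ∈ originRect (x, x), ∫ ξ in Set.Ioc 0 x, g ξ z =
      (originTriangle x).indicator (fun z => F z * (Complex.cos (ω * ((z.1 - z.2 : ℝ) : ℂ)) *
        sincMul ω (x - (z.1 + z.2)))) z := by
    rintro z ⟨⟨hz1, hz1'⟩, ⟨hz2, hz2'⟩⟩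
    have hgz : ∀ ξ, g ξ z = (Set.Icc z.1 (x - z.2)).indicator
        (fun ξ : ℝ => Complex.cos (ω * ((2 * ξ - x : ℝ) : ℂ)) * F z) ξ := by
      intro ξ
      simp only [hg, Set.indicator_apply, Set.mem_ofPred_eq, Set.mem_Icc, le_sub_comm (a := z.2)]
    simp only [hgz]
    rw [setIntegral_indicator measurableSet_Icc,
      Set.inter_eq_right.2 (show Set.Icc z.1 (x - z.2) ⊆ Set.Ioc 0 x from
        fun ξ hξ => ⟨hz1.trans_le hξ.1, hξ.2.trans (by linarith)⟩),
      integral_Icc_eq_integral_Ioc]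
    by_cases hz : z.1 + z.2 ≤ x
    · rw [Set.indicator_of_mem (show z ∈ originTriangle x from ⟨hz1, hz2, hz⟩),
        ← intervalIntegral.integral_of_le (by linarith), intervalIntegral.integral_mul_const,
        integral_cos_two_mul_sub, mul_comm]
    · rw [Set.indicator_of_notMem (fun h => hz h.2.2), Set.Ioc_eq_empty (by intro h; linarith)]
      simp
  have hT := (integral_originTriangle hx (hFT (fun z => Complex.cos (ω * ((z.1 - z.2 : ℝ) : ℂ)) *
        sincMul ω (x - (z.1 + z.2))) (by fun_prop))).2
  rw [hleft, integral_integral_swap hgi,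
    setIntegral_congr_fun (measurableSet_originRect _) hinner,
    setIntegral_indicator (measurableSet_originTriangle x),
    Set.inter_eq_right.2 (originTriangle_subset x), hT]
  refine intervalIntegral.integral_congr fun s _ => ?_
  rw [← hcos, ← intervalIntegral.integral_const_mul]
  refine intervalIntegral.integral_congr fun a _ => ?_
  simp only
  rw [add_sub_cancel a s]
  ring

/-- The power series with coefficients `a`, where it converges. -/
noncomputable def powSeries (a : ℕ → ℂ) (w : ℂ) : ℂ := ∑' n, a n * w ^ n

/-- The coefficients of the derivative of a power series. -/
def derivCoeff (a : ℕ → ℂ) (n : ℕ) : ℂ := (n + 1) * a (n + 1)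

lemma hasDerivAt_powSeries {a : ℕ → ℂ} (ha : ∀ r : ℝ, Summable fun n => ‖a n‖ * r ^ n) (w : ℂ) :
    HasDerivAt (powSeries a) (powSeries (derivCoeff a) w) w := by
  set ρ : ℝ := ‖w‖ + 1 with hρ
  have hρ1 : 1 ≤ ρ := by have := norm_nonneg w; linarith
  have hbound : ∀ n : ℕ, ∀ y ∈ Metric.ball (0 : ℂ) ρ,
      ‖a n * (n * y ^ (n - 1))‖ ≤ ‖a n‖ * (2 * ρ) ^ n := by
    intro n y hy
    rw [norm_mul, norm_mul, norm_pow, Complex.norm_natCast, mul_pow]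
    refine mul_le_mul_of_nonneg_left (mul_le_mul ?_ ?_ (by positivity) (by positivity))
      (norm_nonneg _)
    · exact_mod_cast Nat.lt_two_pow_self.le
    · calc ‖y‖ ^ (n - 1) ≤ ρ ^ (n - 1) :=
            pow_le_pow_left₀ (norm_nonneg _) (by simpa using (mem_ball_zero_iff.1 hy).le) _
        _ ≤ ρ ^ n := pow_le_pow_right₀ hρ1 (Nat.sub_le _ _)
  have hw : w ∈ Metric.ball (0 : ℂ) ρ := by simp [hρ]
  have h := hasDerivAt_tsum_of_isPreconnected (ha (2 * ρ)) Metric.isOpen_ball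
    (convex_ball (0 : ℂ) ρ).isPreconnected
    (g := fun n y => a n * y ^ n) (g' := fun n y => a n * (n * y ^ (n - 1)))
    (fun n y _ => (hasDerivAt_pow n y).const_mul (a n)) hbound hw
    (Summable.of_norm (by simpa using ha ‖w‖)) hw
  refine h.congr_deriv ?_
  rw [(Summable.of_norm_bounded (ha (2 * ρ)) fun n => hbound n w hw).tsum_eq_zero_add]
  simp only [powSeries, derivCoeff, Nat.cast_zero, zero_mul, mul_zero, zero_add,
    Nat.add_sub_cancel, Nat.cast_add, Nat.cast_one]
  exact tsum_congr fun n => by ring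

lemma summable_derivCoeff {a : ℕ → ℂ} (ha : ∀ r : ℝ, Summable fun n => ‖a n‖ * r ^ n) (r : ℝ) :
    Summable fun n => ‖derivCoeff a n‖ * r ^ n := by
  refine Summable.of_norm_bounded
    ((summable_nat_add_iff 1).2 (ha (2 * (|r| + 1)))) fun n => ?_
  rw [norm_mul, norm_norm, derivCoeff, norm_mul, norm_pow, Real.norm_eq_abs, mul_pow]
  have h1 : ‖(n + 1 : ℂ)‖ ≤ 2 ^ (n + 1) := by
    have : ‖(n + 1 : ℂ)‖ = ((n + 1 : ℕ) : ℝ) := by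
      rw [← Complex.norm_natCast]; push_cast; rfl
    rw [this]
    exact_mod_cast (Nat.lt_two_pow_self (n := n + 1)).le
  have h2 : |r| ^ n ≤ (|r| + 1) ^ (n + 1) :=
    (pow_le_pow_left₀ (abs_nonneg r) (by linarith) n).trans
      (pow_le_pow_right₀ (by linarith [abs_nonneg r]) (Nat.le_succ n))
  calc _ = ‖a (n + 1)‖ * (‖(n + 1 : ℂ)‖ * |r| ^ n) := by ring
    _ ≤ _ := mul_le_mul_of_nonneg_left (mul_le_mul h1 h2 (by positivity) (by positivity))
      (norm_nonneg _)

/-- Coefficients of the entire function `w ↦ 𝐛_l(ω,x) / (Γ(l+3/2) x^(l+1))`, `w = (ωx)²`. -/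
noncomputable def besselCoeff (l : ℝ) (k : ℕ) : ℂ :=
  (-1) ^ k / ((2 : ℂ) ^ (2 * k) * (Real.Gamma (k + 1) : ℂ) * (Real.Gamma (k + l + 3 / 2) : ℂ))

lemma besselCoeff_succ {l : ℝ} (hl : -1 < l) (k : ℕ) :
    4 * (k + 1) * (k + l + 3 / 2) * besselCoeff l (k + 1) = - besselCoeff l k := by
  have hk : (0 : ℝ) ≤ k := Nat.cast_nonneg k
  have h1 : (0 : ℝ) < k + 1 := by positivity
  have h2 : (0 : ℝ) < k + l + 3 / 2 := by linarith
  have g1 : Real.Gamma ((k + 1 : ℕ) + 1) = (k + 1) * Real.Gamma (k + 1) := by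
    push_cast; exact Real.Gamma_add_one h1.ne'
  have g2 : Real.Gamma ((k + 1 : ℕ) + l + 3 / 2) = (k + l + 3 / 2) * Real.Gamma (k + l + 3 / 2) := by
    rw [← Real.Gamma_add_one h2.ne']; push_cast; ring_nf
  have p1 : (Real.Gamma (k + 1) : ℂ) ≠ 0 := by exact_mod_cast (Real.Gamma_pos_of_pos h1).ne'
  have p2 : (Real.Gamma (k + l + 3 / 2) : ℂ) ≠ 0 := by
    exact_mod_cast (Real.Gamma_pos_of_pos h2).ne'
  have p3 : ((k : ℂ) + 1) ≠ 0 := by exact_mod_cast h1.ne'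
  have p4 : ((k : ℂ) + l + 3 / 2) ≠ 0 := by
    have : ((k + l + 3 / 2 : ℝ) : ℂ) ≠ 0 := by exact_mod_cast h2.ne'
    simpa using this
  rw [besselCoeff, besselCoeff, g1, g2]
  push_cast
  rw [show 2 * (k + 1) = 2 * k + 2 by ring, pow_add, pow_succ]
  generalize (k : ℂ) + l + 3 / 2 = D at *
  generalize (Real.Gamma (k + 1) : ℂ) = A at *
  generalize (Real.Gamma (k + l + 3 / 2) : ℂ) = B at *
  have p5 : (2 : ℂ) ^ (2 * k) ≠ 0 := pow_ne_zero _ two_ne_zero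
  field_simp
  ring

lemma besselCoeff_ne_zero {l : ℝ} (hl : -1 < l) (k : ℕ) : besselCoeff l k ≠ 0 := by
  have hk : (0 : ℝ) ≤ k := Nat.cast_nonneg k
  have p1 : (Real.Gamma (k + 1) : ℂ) ≠ 0 := by
    exact_mod_cast (Real.Gamma_pos_of_pos (by positivity)).ne'
  have p2 : (Real.Gamma (k + l + 3 / 2) : ℂ) ≠ 0 := by
    exact_mod_cast (Real.Gamma_pos_of_pos (by linarith)).ne'
  exact div_ne_zero (pow_ne_zero _ (by simp))
    (mul_ne_zero (mul_ne_zero (pow_ne_zero _ two_ne_zero) p1) p2)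

lemma summable_besselCoeff {l : ℝ} (hl : -1 < l) (r : ℝ) :
    Summable fun k => ‖besselCoeff l k‖ * r ^ k := by
  by_cases hr : r = 0
  · refine summable_of_ne_finset_zero (s := {0}) fun k hk => ?_
    rw [hr, zero_pow (by simpa using hk), mul_zero]
  refine summable_of_ratio_test_tendsto_lt_one zero_lt_one (.of_forall fun k =>
    mul_ne_zero (norm_ne_zero_iff.2 (besselCoeff_ne_zero hl k)) (pow_ne_zero _ hr)) ?_
  have hratio : ∀ k : ℕ, ‖‖besselCoeff l (k + 1)‖ * r ^ (k + 1)‖ / ‖‖besselCoeff l k‖ * r ^ k‖ =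
      |r| / 4 * ((k + 1 : ℝ)⁻¹ * (k + l + 3 / 2)⁻¹) := by
    intro k
    have hk : (0 : ℝ) ≤ k := Nat.cast_nonneg k
    have h1 : (0 : ℝ) < k + 1 := by positivity
    have h2 : (0 : ℝ) < k + l + 3 / 2 := by linarith
    have e := congrArg norm (besselCoeff_succ hl k)
    have e1 : (4 * (k + 1) * (k + l + 3 / 2) : ℂ) =
        ((4 * (k + 1) * (k + l + 3 / 2) : ℝ) : ℂ) := by push_cast; ring
    rw [norm_neg, e1, norm_mul, Complex.norm_real, Real.norm_of_nonneg (by positivity)] at e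
    have hne : ‖besselCoeff l (k + 1)‖ ≠ 0 := norm_ne_zero_iff.2 (besselCoeff_ne_zero hl _)
    have hr' : |r| ≠ 0 := abs_ne_zero.2 hr
    rw [norm_mul, norm_mul, norm_norm, norm_norm, ← e, norm_pow, norm_pow, Real.norm_eq_abs]
    field_simp
    rw [pow_succ]
  simp_rw [hratio]
  have t1 : Tendsto (fun k : ℕ => (k + 1 : ℝ)⁻¹) atTop (nhds 0) :=
    tendsto_inv_atTop_zero.comp (tendsto_atTop_add_const_right _ _ tendsto_natCast_atTop_atTop)
  have t2 : Tendsto (fun k : ℕ => (k + l + 3 / 2 : ℝ)⁻¹) atTop (nhds 0) :=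
    tendsto_inv_atTop_zero.comp (tendsto_atTop_add_const_right _ _
      (tendsto_atTop_add_const_right _ _ tendsto_natCast_atTop_atTop))
  simpa using (t1.mul t2).const_mul (|r| / 4)

lemma besselSeries_ode {l : ℝ} (hl : -1 < l) (w : ℂ) :
    4 * w * powSeries (derivCoeff (derivCoeff (besselCoeff l))) w +
      (4 * l + 6) * powSeries (derivCoeff (besselCoeff l)) w + powSeries (besselCoeff l) w = 0 := by
  set a := besselCoeff l with ha
  have sa : ∀ r : ℝ, Summable fun n => ‖a n‖ * r ^ n := summable_besselCoeff hl
  have s0 : Summable fun n => a n * w ^ n := Summable.of_norm (by simpa using sa ‖w‖)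
  have s1 : Summable fun n => derivCoeff a n * w ^ n :=
    Summable.of_norm (by simpa using summable_derivCoeff sa ‖w‖)
  have s2 : Summable fun n => derivCoeff (derivCoeff a) n * w ^ n :=
    Summable.of_norm (by simpa using summable_derivCoeff (summable_derivCoeff sa) ‖w‖)
  have s3 : HasSum (fun n : ℕ => 4 * n * derivCoeff a n * w ^ n)
      (4 * w * powSeries (derivCoeff (derivCoeff a)) w) := by
    refine (hasSum_nat_add_iff' 1).1 ?_
    simp only [Finset.range_one, Finset.sum_singleton, Nat.cast_zero, mul_zero, zero_mul, sub_zero]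
    refine (s2.hasSum.mul_left (4 * w)).congr_fun fun n => ?_
    simp only [derivCoeff]
    push_cast
    ring
  have h := (s3.add (s1.hasSum.mul_left (4 * l + 6 : ℂ))).add s0.hasSum
  refine h.unique ?_
  refine hasSum_zero.congr_fun fun n => ?_
  have := besselCoeff_succ hl n
  rw [← ha] at this
  simp only [derivCoeff]
  linear_combination w ^ n * this

lemma blFn_eq_powSeries (l : ℝ) (ω : ℂ) {x : ℝ} (hx : 0 ≤ x) :
    blFn l ω x = (Real.Gamma (l + 3 / 2) : ℂ) *
      (((x ^ (l + 1) : ℝ) : ℂ) * powSeries (besselCoeff l) (ω ^ 2 * ((x ^ 2 : ℝ) : ℂ))) := by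
  rw [blFn, Complex.ofReal_cpow hx, mul_assoc]
  push_cast
  congr 2
  refine tsum_congr fun k => ?_
  rw [besselCoeff, ← mul_pow, ← pow_mul]
  ring

theorem exists_hasDerivAt_blFn {l : ℝ} (hl : -1 < l) (ω : ℂ) :
    ∃ v : ℝ → ℂ, ∀ x, 0 < x → HasDerivAt (blFn l ω) (v x) x ∧
      HasDerivAt v ((((l * (l + 1) / x ^ 2 : ℝ) : ℂ) - ω ^ 2) * blFn l ω x) x := by
  set a := besselCoeff l with ha
  have sa : ∀ r : ℝ, Summable fun n => ‖a n‖ * r ^ n := summable_besselCoeff hl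
  set g : ℂ := (Real.Gamma (l + 3 / 2) : ℂ)
  have hbl : ∀ x : ℝ, 0 < x → blFn l ω x = g *
      (((x ^ (l + 1) : ℝ) : ℂ) * powSeries a (ω ^ 2 * ((x ^ 2 : ℝ) : ℂ))) :=
    fun x hx => blFn_eq_powSeries l ω hx.le
  have hw : ∀ x : ℝ, HasDerivAt (fun x : ℝ => ω ^ 2 * ((x ^ 2 : ℝ) : ℂ))
      (ω ^ 2 * ((2 * x : ℝ) : ℂ)) x := by
    intro x
    have : HasDerivAt (fun x : ℝ => x ^ 2) (2 * x) x := by simpa using hasDerivAt_pow 2 x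
    exact this.ofReal_comp.const_mul _
  have hf : ∀ c : ℕ → ℂ, (∀ r : ℝ, Summable fun n => ‖c n‖ * r ^ n) → ∀ x : ℝ,
      HasDerivAt (fun x : ℝ => powSeries c (ω ^ 2 * ((x ^ 2 : ℝ) : ℂ)))
        (powSeries (derivCoeff c) (ω ^ 2 * ((x ^ 2 : ℝ) : ℂ)) * (ω ^ 2 * ((2 * x : ℝ) : ℂ))) x :=
    fun c hc x => (hasDerivAt_powSeries hc _).comp x (hw x)
  have hp : ∀ (m x : ℝ), 0 < x → HasDerivAt (fun x : ℝ => ((x ^ m : ℝ) : ℂ))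
      ((m * x ^ (m - 1) : ℝ) : ℂ) x :=
    fun m x hx => (Real.hasDerivAt_rpow_const (Or.inl hx.ne')).ofReal_comp
  refine ⟨fun x => g * (((((l + 1) * x ^ l : ℝ) : ℂ)) * powSeries a (ω ^ 2 * ((x ^ 2 : ℝ) : ℂ)) +
    2 * ω ^ 2 * (((x ^ (l + 2) : ℝ) : ℂ) *
      powSeries (derivCoeff a) (ω ^ 2 * ((x ^ 2 : ℝ) : ℂ)))), fun x hx => ⟨?_, ?_⟩⟩
  · have h := ((hp (l + 1) x hx).mul (hf a sa x)).const_mul g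
    refine (h.congr_of_eventuallyEq ?_).congr_deriv ?_
    · filter_upwards [lt_mem_nhds hx] with y hy
      exact hbl y hy
    · have e : x ^ (l + 2) = x ^ (l + 1) * x := by
        rw [← Real.rpow_add_one hx.ne']; ring_nf
      simp only
      rw [e, show l + 1 - 1 = l by ring]
      push_cast
      ring
  · have h1 := (((hp l x hx).const_mul (l + 1 : ℂ)).mul (hf a sa x))
    have h2 := (((hp (l + 2) x hx).mul (hf _ (summable_derivCoeff sa) x)).const_mul (2 * ω ^ 2))
    have h := (h1.add h2).const_mul g
    refine (h.congr_of_eventuallyEq ?_).congr_deriv ?_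
    · refine .of_forall fun y => ?_
      simp
    · have hode := besselSeries_ode hl (ω ^ 2 * ((x ^ 2 : ℝ) : ℂ))
      rw [← ha] at hode
      rw [hbl x hx]
      have e0 : x ^ (l - 1) = x ^ l / x := Real.rpow_sub_one hx.ne' l
      have e1 : x ^ (l + 1) = x ^ l * x := Real.rpow_add_one hx.ne' l
      have e2 : x ^ (l + 2) = x ^ l * x ^ 2 := by
        rw [Real.rpow_add hx]; norm_cast
      have e3 : x ^ (l + 2 - 1) = x ^ l * x := by rw [← e1]; ring_nf
      rw [e0, e1, e2, e3]
      have hx' : (x : ℂ) ≠ 0 := by exact_mod_cast hx.ne'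
      push_cast at hode ⊢
      generalize powSeries a (ω ^ 2 * (x : ℂ) ^ 2) = f0 at *
      generalize powSeries (derivCoeff a) (ω ^ 2 * (x : ℂ) ^ 2) = f1 at *
      generalize powSeries (derivCoeff (derivCoeff a)) (ω ^ 2 * (x : ℂ) ^ 2) = f2 at *
      field_simp
      linear_combination g * ((x ^ l : ℝ) : ℂ) * ω ^ 2 * (x : ℂ) ^ 2 * hode

lemma intervalIntegrable_besselKernel {l : ℝ} (hl : -1 < l) {x : ℝ} (hx : 0 ≤ x) :
    IntervalIntegrable (fun ξ => besselKernel l (ξ, x - ξ)) volume 0 x := by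
  have h1 : IntervalIntegrable (fun ξ : ℝ => ξ ^ l) volume 0 x :=
    intervalIntegral.intervalIntegrable_rpow' hl
  have h2 : IntervalIntegrable (fun ξ : ℝ => (x - ξ) ^ l) volume 0 x := by
    simpa using (h1.comp_sub_left x).symm
  have hm := measurable_besselKernel l
  refine (h1.add h2).mono_fun' (Measurable.aestronglyMeasurable (by fun_prop)) ?_
  rw [Set.uIoc_of_le hx, ← restrict_Ioo_eq_restrict_Ioc]
  refine (ae_restrict_iff' measurableSet_Ioo).2 (.of_forall fun ξ hξ => ?_)
  have ha : 0 < ξ := hξ.1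
  have hc : 0 < x - ξ := sub_pos.2 hξ.2
  have h0 : 0 ≤ besselKernel l (ξ, x - ξ) := Real.rpow_nonneg (by simp only; positivity) _
  exact (Real.norm_of_nonneg h0).trans_le (rpow_mul_div_add_le hl.le ha hc)

lemma intervalIntegrable_rpow_mul_one_sub {l : ℝ} (hl : -1 < l) :
    IntervalIntegrable (fun σ : ℝ => (σ * (1 - σ)) ^ l) volume 0 1 := by
  simpa [besselKernel] using intervalIntegrable_besselKernel hl zero_le_one

lemma integral_rpow_mul_one_sub {l : ℝ} (hl : -1 < l) :
    ∫ σ in (0 : ℝ)..1, (σ * (1 - σ)) ^ l =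
      (4 : ℝ) ^ (-l) / 2 * Real.sqrt Real.pi * Real.Gamma (l + 1) / Real.Gamma (l + 3 / 2) := by
  have hl1 : 0 < l + 1 := by linarith
  have hb : ((∫ σ in (0 : ℝ)..1, (σ * (1 - σ)) ^ l : ℝ) : ℂ) =
      Complex.betaIntegral ((l + 1 : ℝ) : ℂ) ((l + 1 : ℝ) : ℂ) := by
    rw [← intervalIntegral.integral_ofReal, Complex.betaIntegral]
    refine intervalIntegral.integral_congr fun σ hσ => ?_
    rw [Set.uIcc_of_le zero_le_one] at hσ
    have h2 : 0 ≤ 1 - σ := sub_nonneg.2 hσ.2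
    rw [Real.mul_rpow hσ.1 h2, Complex.ofReal_mul, Complex.ofReal_cpow hσ.1,
      Complex.ofReal_cpow h2]
    push_cast
    simp
  have hG := Complex.Gamma_mul_Gamma_eq_betaIntegral (s := ((l + 1 : ℝ) : ℂ))
    (t := ((l + 1 : ℝ) : ℂ)) (by simpa using hl1) (by simpa using hl1)
  rw [← hb, ← Complex.ofReal_add, Complex.Gamma_ofReal, Complex.Gamma_ofReal] at hG
  have hG' : Real.Gamma (l + 1) * Real.Gamma (l + 1) = Real.Gamma (l + 1 + (l + 1)) *
      ∫ σ in (0 : ℝ)..1, (σ * (1 - σ)) ^ l := by exact_mod_cast hG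
  have hdup := Real.Gamma_mul_Gamma_add_half (l + 1)
  rw [show l + 1 + 1 / 2 = l + 3 / 2 by ring, ← two_mul] at *
  have e4 : (2 : ℝ) ^ (1 - 2 * (l + 1)) = (4 : ℝ) ^ (-l) / 2 := by
    rw [show (4 : ℝ) = 2 ^ (2 : ℝ) by norm_num, ← Real.rpow_mul zero_le_two,
      ← Real.rpow_sub_one two_ne_zero]
    ring_nf
  rw [e4] at hdup
  have p1 : 0 < Real.Gamma (l + 3 / 2) := Real.Gamma_pos_of_pos (by linarith)
  have p2 : 0 < Real.Gamma (2 * (l + 1)) := Real.Gamma_pos_of_pos (by linarith)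
  rw [eq_div_iff p1.ne']
  refine mul_left_cancel₀ p2.ne' ?_
  linear_combination (-Real.Gamma (l + 3 / 2)) * hG' + Real.Gamma (l + 1) * hdup

/-- Even moments of the ultraspherical weight. -/
lemma integral_rpow_mul_one_sub_mul_pow (k : ℕ) : ∀ {l : ℝ}, -1 < l →
    ∫ σ in (0 : ℝ)..1, (σ * (1 - σ)) ^ l * (2 * σ - 1) ^ (2 * k) =
      (4 : ℝ) ^ (-l) / 2 * Real.Gamma (k + 1 / 2) * Real.Gamma (l + 1) /
        Real.Gamma (k + l + 3 / 2) := by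
  induction k with
  | zero =>
    intro l hl
    have hG := Real.Gamma_one_half_eq
    rw [one_div] at hG
    simpa [hG] using integral_rpow_mul_one_sub hl
  | succ k ih =>
    intro l hl
    have hk : (0 : ℝ) ≤ k := Nat.cast_nonneg k
    have hinteg : ∀ m : ℝ, -1 < m → IntervalIntegrable
        (fun σ : ℝ => (σ * (1 - σ)) ^ m * (2 * σ - 1) ^ (2 * k)) volume 0 1 := fun m hm =>
      (intervalIntegrable_rpow_mul_one_sub hm).mul_continuousOn (by fun_prop)
    have hrec : ∫ σ in (0 : ℝ)..1, (σ * (1 - σ)) ^ l * (2 * σ - 1) ^ (2 * (k + 1)) =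
        (∫ σ in (0 : ℝ)..1, (σ * (1 - σ)) ^ l * (2 * σ - 1) ^ (2 * k)) -
          4 * ∫ σ in (0 : ℝ)..1, (σ * (1 - σ)) ^ (l + 1) * (2 * σ - 1) ^ (2 * k) := by
      rw [← intervalIntegral.integral_const_mul, ← intervalIntegral.integral_sub (hinteg l hl)
        ((hinteg (l + 1) (by linarith)).const_mul 4)]
      rw [intervalIntegral.integral_of_le zero_le_one, intervalIntegral.integral_of_le zero_le_one,
        integral_Ioc_eq_integral_Ioo, integral_Ioc_eq_integral_Ioo]
      refine setIntegral_congr_fun measurableSet_Ioo fun σ hσ => ?_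
      have hne : σ * (1 - σ) ≠ 0 := mul_ne_zero hσ.1.ne' (sub_pos.2 hσ.2).ne'
      rw [Real.rpow_add_one hne]
      ring
    rw [hrec, ih hl, ih (show -1 < l + 1 by linarith)]
    have g1 : Real.Gamma ((k + 1 : ℕ) + 1 / 2) = (k + 1 / 2) * Real.Gamma (k + 1 / 2) := by
      rw [← Real.Gamma_add_one (by positivity)]; push_cast; ring_nf
    have g2 : Real.Gamma (l + 1 + 1) = (l + 1) * Real.Gamma (l + 1) :=
      Real.Gamma_add_one (by linarith)
    have hD : (0 : ℝ) < k + l + 3 / 2 := by linarith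
    have g3 : Real.Gamma (k + (l + 1) + 3 / 2) = (k + l + 3 / 2) * Real.Gamma (k + l + 3 / 2) := by
      rw [← Real.Gamma_add_one hD.ne']; ring_nf
    have g4 : Real.Gamma ((k + 1 : ℕ) + l + 3 / 2) =
        (k + l + 3 / 2) * Real.Gamma (k + l + 3 / 2) := by
      rw [← Real.Gamma_add_one hD.ne']; push_cast; ring_nf
    have e4 : (4 : ℝ) ^ (-(l + 1)) = (4 : ℝ) ^ (-l) / 4 := by
      rw [← Real.rpow_sub_one (by norm_num)]; ring_nf
    rw [g1, g2, g3, g4, e4]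
    have p1 := Real.Gamma_pos_of_pos hD
    have key : (k : ℝ) + 1 / 2 = (k + l + 3 / 2) - (l + 1) := by ring
    rw [key]
    generalize (k : ℝ) + l + 3 / 2 = D at *
    field_simp

lemma Gamma_nat_add_half_div_factorial (k : ℕ) :
    Real.Gamma (k + 1 / 2) / (2 * k).factorial =
      Real.sqrt Real.pi / (2 ^ (2 * k) * Real.Gamma (k + 1)) := by
  have h := Real.Gamma_mul_Gamma_add_half ((k : ℝ) + 1 / 2)
  have e : Real.Gamma (2 * ((k : ℝ) + 1 / 2)) = (2 * k).factorial := by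
    rw [← Real.Gamma_nat_eq_factorial]; push_cast; ring_nf
  have e2 : (2 : ℝ) ^ (1 - 2 * ((k : ℝ) + 1 / 2)) = ((2 : ℝ) ^ (2 * k))⁻¹ := by
    rw [← Real.rpow_natCast, ← Real.rpow_neg zero_le_two]; push_cast; ring_nf
  rw [e, e2, show (k : ℝ) + 1 / 2 + 1 / 2 = k + 1 by ring] at h
  have p : 0 < Real.Gamma ((k : ℝ) + 1) := Real.Gamma_pos_of_pos (by positivity)
  rw [div_eq_div_iff (by positivity) (by positivity)]
  rw [show Real.Gamma (k + 1 / 2) * (2 ^ (2 * k) * Real.Gamma (k + 1)) =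
    2 ^ (2 * k) * (Real.Gamma (k + 1 / 2) * Real.Gamma (k + 1)) by ring, h]
  field_simp

/-- Poisson's integral representation of `𝐛_l`. -/
theorem charCos_besselKernel {l : ℝ} (hl : -1 < l) (ω : ℂ) {x : ℝ} (hx : 0 < x) :
    charCos ω (fun z => (besselKernel l z : ℂ)) x =
      (((4 : ℝ) ^ (-l) / 2 * Real.sqrt Real.pi * Real.Gamma (l + 1) / Real.Gamma (l + 3 / 2) : ℝ) : ℂ)
        * blFn l ω x := by
  have hscale : charCos ω (fun z => (besselKernel l z : ℂ)) x =
      ((x ^ (l + 1) : ℝ) : ℂ) * ∫ σ in (0 : ℝ)..1, (((σ * (1 - σ)) ^ l : ℝ) : ℂ) *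
        Complex.cos (ω * x * ((2 * σ - 1 : ℝ) : ℂ)) := by
    have h := intervalIntegral.smul_integral_comp_mul_left (E := ℂ) (a := 0) (b := 1)
      (fun ξ : ℝ => ((besselKernel l (ξ, x - ξ) : ℝ) : ℂ) * Complex.cos (ω * ((2 * ξ - x : ℝ) : ℂ))) x
    rw [mul_zero, mul_one] at h
    rw [charCos, ← h, Real.rpow_add_one hx.ne', mul_comm (x ^ l), Complex.ofReal_mul, mul_assoc,
      Complex.real_smul]
    refine congrArg ((x : ℂ) * ·) ?_
    rw [← intervalIntegral.integral_const_mul]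
    refine intervalIntegral.integral_congr fun σ hσ => ?_
    rw [Set.uIcc_of_le zero_le_one] at hσ
    have h2 : 0 ≤ 1 - σ := sub_nonneg.2 hσ.2
    have e1 : besselKernel l (x * σ, x - x * σ) = x ^ l * (σ * (1 - σ)) ^ l := by
      rw [besselKernel, ← Real.mul_rpow hx.le (mul_nonneg hσ.1 h2)]
      congr 1
      simp only
      field_simp
      ring
    have e2 : ω * ((2 * (x * σ) - x : ℝ) : ℂ) = ω * x * ((2 * σ - 1 : ℝ) : ℂ) := by
      push_cast; ring
    rw [e1, e2]
    push_cast
    ring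
  have hsum : HasSum (fun k : ℕ => ∫ σ in (0 : ℝ)..1, (((σ * (1 - σ)) ^ l : ℝ) : ℂ) *
      ((-1) ^ k * (ω * x * ((2 * σ - 1 : ℝ) : ℂ)) ^ (2 * k) / ((2 * k).factorial : ℂ)))
      (∫ σ in (0 : ℝ)..1, (((σ * (1 - σ)) ^ l : ℝ) : ℂ) *
        Complex.cos (ω * x * ((2 * σ - 1 : ℝ) : ℂ))) := by
    have hs : Summable fun k : ℕ => ‖ω * x‖ ^ (2 * k) / ((2 * k).factorial : ℝ) :=
      (Real.summable_pow_div_factorial ‖ω * x‖).comp_injective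
        (mul_right_injective₀ (two_ne_zero' ℕ))
    refine intervalIntegral.hasSum_integral_of_dominated_convergence
      (fun k σ => (σ * (1 - σ)) ^ l * (‖ω * x‖ ^ (2 * k) / ((2 * k).factorial : ℝ)))
      (fun k => Measurable.aestronglyMeasurable (by fun_prop)) (fun k => .of_forall fun σ hσ => ?_)
      (.of_forall fun σ _ => hs.mul_left _) ?_
      (.of_forall fun σ _ => (Complex.hasSum_cos _).mul_left _)
    · rw [Set.uIoc_of_le zero_le_one] at hσ
      have h2 : 0 ≤ 1 - σ := sub_nonneg.2 hσ.2
      have h3 : 0 ≤ σ * (1 - σ) := mul_nonneg hσ.1.le h2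
      have h4 : |2 * σ - 1| ≤ 1 := abs_le.2 ⟨by linarith [hσ.1], by linarith [hσ.2]⟩
      rw [norm_mul, Complex.norm_real, Real.norm_of_nonneg (Real.rpow_nonneg h3 _), norm_div,
        norm_mul, norm_pow, norm_pow, norm_neg, norm_one, one_pow, one_mul, Complex.norm_natCast,
        norm_mul, Complex.norm_real, Real.norm_eq_abs]
      have h5 : ‖ω * x‖ * |2 * σ - 1| ≤ ‖ω * x‖ := mul_le_of_le_one_right (norm_nonneg _) h4
      gcongr
    · simp only [tsum_mul_left]
      exact (intervalIntegrable_rpow_mul_one_sub hl).mul_const _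
  rw [hscale, ← hsum.tsum_eq, blFn, Complex.ofReal_cpow hx.le]
  have hterm : ∀ k : ℕ, ∫ σ in (0 : ℝ)..1, (((σ * (1 - σ)) ^ l : ℝ) : ℂ) *
      ((-1) ^ k * (ω * x * ((2 * σ - 1 : ℝ) : ℂ)) ^ (2 * k) / ((2 * k).factorial : ℂ)) =
      (((4 : ℝ) ^ (-l) / 2 * Real.sqrt Real.pi * Real.Gamma (l + 1) : ℝ) : ℂ) *
        ((-1) ^ k * (ω * x) ^ (2 * k) / ((2 : ℂ) ^ (2 * k) * (Real.Gamma (k + 1) : ℂ) *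
          (Real.Gamma (k + l + 3 / 2) : ℂ))) := by
    intro k
    have e1 : ∀ σ : ℝ, (((σ * (1 - σ)) ^ l : ℝ) : ℂ) *
        ((-1) ^ k * (ω * x * ((2 * σ - 1 : ℝ) : ℂ)) ^ (2 * k) / ((2 * k).factorial : ℂ)) =
        ((-1) ^ k * (ω * x) ^ (2 * k) / ((2 * k).factorial : ℂ)) *
          (((σ * (1 - σ)) ^ l * (2 * σ - 1) ^ (2 * k) : ℝ) : ℂ) := by
      intro σ
      rw [mul_pow, Complex.ofReal_mul, Complex.ofReal_pow]
      ring
    simp only [e1]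
    rw [intervalIntegral.integral_const_mul, intervalIntegral.integral_ofReal,
      integral_rpow_mul_one_sub_mul_pow k hl]
    have h := congrArg (fun r : ℝ => (r : ℂ)) (Gamma_nat_add_half_div_factorial k)
    push_cast at h ⊢
    calc _ = (-1) ^ k * (ω * x) ^ (2 * k) * (((4 : ℝ) ^ (-l) : ℝ) : ℂ) / 2 *
          (Real.Gamma (k + 1 / 2) / ((2 * k).factorial : ℂ)) * Real.Gamma (l + 1) /
            Real.Gamma (k + l + 3 / 2) := by ring
      _ = _ := by rw [h]; ring
  simp only [hterm]
  rw [tsum_mul_left]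
  have p : (Real.Gamma (l + 3 / 2) : ℂ) ≠ 0 := by
    exact_mod_cast (Real.Gamma_pos_of_pos (by linarith)).ne'
  have hcancel : ∀ A X S g : ℂ, g ≠ 0 → X * (A * S) = A / g * (g * X * S) := by
    intro A X S g hg
    field_simp
  rw [Complex.ofReal_div, Complex.ofReal_add, Complex.ofReal_one]
  exact hcancel _ _ _ _ p

/-- Duhamel's formula for `v'' + ω² v = h`, with a source `h` that is only integrable at `0`. -/
lemma exists_hasDerivAt_duhamel {ω : ℂ} {h v : ℝ → ℂ}
    (hinteg : ∀ x, 0 < x → IntervalIntegrable h volume 0 x) (hcont : ContinuousOn h (Set.Ioi 0))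
    (hv : ∀ x, 0 < x → v x = ∫ s in (0 : ℝ)..x, sincMul ω (x - s) * h s) :
    ∃ v' : ℝ → ℂ, ∀ x, 0 < x → HasDerivAt v (v' x) x ∧
      HasDerivAt v' (h x - ω ^ 2 * v x) x := by
  have hsc : Continuous (sincMul ω) :=
    continuous_iff_continuousAt.2 fun r => (hasDerivAt_sincMul ω r).continuousAt
  set C : ℝ → ℂ := fun x => ∫ s in (0 : ℝ)..x, Complex.cos (ω * s) * h s with hC
  set S : ℝ → ℂ := fun x => ∫ s in (0 : ℝ)..x, sincMul ω s * h s with hS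
  have hder : ∀ {g : ℝ → ℂ}, Continuous g → ∀ x, 0 < x →
      IntervalIntegrable (fun s => g s * h s) volume 0 x ∧
        HasDerivAt (fun x => ∫ s in (0 : ℝ)..x, g s * h s) (g x * h x) x := by
    intro g hg x hx
    have hi := (hinteg x hx).continuousOn_mul hg.continuousOn
    have hc : ContinuousOn (fun s => g s * h s) (Set.Ioi 0) := hg.continuousOn.mul hcont
    exact ⟨hi, intervalIntegral.integral_hasDerivAt_right hi
      (hc.stronglyMeasurableAtFilter isOpen_Ioi x hx) (hc.continuousAt (Ioi_mem_nhds hx))⟩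
  have hcosc : Continuous fun s : ℝ => Complex.cos (ω * s) := by fun_prop
  have hcos : ∀ x : ℝ, HasDerivAt (fun x : ℝ => Complex.cos (ω * x)) (-ω ^ 2 * sincMul ω x) x := by
    intro x
    have h1 : HasDerivAt (fun ρ : ℝ => ω * (ρ : ℂ)) (ω * 1) x :=
      (Complex.ofRealCLM.hasDerivAt (x := x)).const_mul ω
    refine ((Complex.hasDerivAt_cos _).comp x h1).congr_deriv ?_
    rw [← mul_sincMul]
    ring
  have hrep : ∀ x, 0 < x → v x = sincMul ω x * C x - Complex.cos (ω * x) * S x := by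
    intro x hx
    rw [hv x hx, hC, hS]
    simp only
    rw [← intervalIntegral.integral_const_mul, ← intervalIntegral.integral_const_mul,
      ← intervalIntegral.integral_sub ((hder hcosc x hx).1.const_mul _)
        ((hder hsc x hx).1.const_mul _)]
    refine intervalIntegral.integral_congr fun s _ => ?_
    simp only [sincMul_sub]
    ring
  refine ⟨fun x => Complex.cos (ω * x) * C x + ω ^ 2 * (sincMul ω x * S x), fun x hx => ⟨?_, ?_⟩⟩
  · have h1 := ((hasDerivAt_sincMul ω x).mul (hder hcosc x hx).2).sub
      ((hcos x).mul (hder hsc x hx).2)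
    refine (h1.congr_of_eventuallyEq ?_).congr_deriv (by ring)
    filter_upwards [Ioi_mem_nhds hx] with y hy using hrep y hy
  · refine (((hcos x).mul (hder hcosc x hx).2).add
      (((hasDerivAt_sincMul ω x).mul (hder hsc x hx).2).const_mul (ω ^ 2))).congr_deriv ?_
    have hsq : Complex.cos (ω * x) ^ 2 + ω ^ 2 * sincMul ω x ^ 2 = 1 := by
      rw [← mul_pow, mul_sincMul, Complex.cos_sq_add_sin_sq]
    rw [hrep x hx]
    linear_combination (h x) * hsq

lemma continuous_charCos (ω : ℂ) {R : ℝ × ℝ → ℂ} (hR : Continuous R) :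
    Continuous (charCos ω R) :=
  intervalIntegral.continuous_parametric_intervalIntegral_of_continuous
    (f := fun x ξ : ℝ => R (ξ, x - ξ) * Complex.cos (ω * ((2 * ξ - x : ℝ) : ℂ)))
    (by simp only [Function.uncurry_def]; fun_prop) continuous_id

lemma charCos_eq_integral_cos (ω : ℂ) {R : ℝ × ℝ → ℂ} (hR : Continuous R) (x : ℝ) :
    charCos ω R x = ∫ t in (0 : ℝ)..x, 1 / 2 * (R ((x + t) / 2, (x - t) / 2) +
      R ((x - t) / 2, (x + t) / 2)) * Complex.cos (ω * t) := by
  set g : ℝ → ℂ := fun t => 1 / 2 * R ((x + t) / 2, (x - t) / 2) * Complex.cos (ω * t) with hg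
  have hgc : Continuous g := by rw [hg]; fun_prop
  have hgn : Continuous fun t => g (-t) := hgc.comp continuous_neg
  have h1 := intervalIntegral.smul_integral_comp_mul_sub (E := ℂ) (a := 0) (b := x) g 2 x
  rw [mul_zero, zero_sub, show 2 * x - x = x by ring, Complex.real_smul,
    ← intervalIntegral.integral_const_mul] at h1
  have h2 : charCos ω R x = ∫ t in (-x)..x, g t := by
    rw [← h1, charCos]
    refine intervalIntegral.integral_congr fun ξ _ => ?_
    have e1 : (x + (2 * ξ - x)) / 2 = ξ := by ring
    have e2 : (x - (2 * ξ - x)) / 2 = x - ξ := by ring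
    simp only [hg, e1, e2]
    push_cast
    ring
  have h3 := intervalIntegral.integral_comp_neg (a := 0) (b := x) g
  rw [neg_zero] at h3
  rw [h2, ← intervalIntegral.integral_add_adjacent_intervals (hgc.intervalIntegrable (-x) 0)
    (hgc.intervalIntegrable 0 x), ← h3, ← intervalIntegral.integral_add
      (hgn.intervalIntegrable 0 x) (hgc.intervalIntegrable 0 x)]
  refine intervalIntegral.integral_congr fun t _ => ?_
  simp only [hg, Complex.ofReal_neg, mul_neg, Complex.cos_neg, sub_neg_eq_add, ← sub_eq_add_neg]
  ring

lemma charCos_bessel_source {l : ℝ} (hl : -1 < l) (Q : ℝ → ℂ) {R : ℝ × ℝ → ℂ}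
    (hR : Continuous R) (ω : ℂ) {x : ℝ} (hx : 0 ≤ x) :
    charCos ω (fun z => Q (z.1 + z.2) * besselKernel l z + besselPotential l Q (z.1 + z.2) * R z) x =
      Q x * charCos ω (fun z => (besselKernel l z : ℂ)) x +
        besselPotential l Q x * charCos ω R x := by
  have h0 : IntervalIntegrable (fun ξ : ℝ => (besselKernel l (ξ, x - ξ) : ℂ)) volume 0 x :=
    ⟨(intervalIntegrable_besselKernel hl hx).1.ofReal,
      (intervalIntegrable_besselKernel hl hx).2.ofReal⟩
  have h1 : IntervalIntegrable (fun ξ : ℝ => (besselKernel l (ξ, x - ξ) : ℂ) *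
      Complex.cos (ω * ((2 * ξ - x : ℝ) : ℂ))) volume 0 x :=
    h0.mul_continuousOn (Continuous.continuousOn (by fun_prop))
  have h2 : IntervalIntegrable (fun ξ : ℝ => R (ξ, x - ξ) *
      Complex.cos (ω * ((2 * ξ - x : ℝ) : ℂ))) volume 0 x :=
    Continuous.intervalIntegrable (by fun_prop) _ _
  unfold charCos
  rw [← intervalIntegral.integral_const_mul, ← intervalIntegral.integral_const_mul,
    ← intervalIntegral.integral_add (h1.const_mul _) (h2.const_mul _)]
  refine intervalIntegral.integral_congr fun ξ _ => ?_
  simp only [add_sub_cancel]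
  ring

/-- A continuous kernel whose cosine transform corrects that of `besselKernel` to a solution of
the perturbed Bessel equation. -/
theorem exists_bessel_cosine_kernel {l : ℝ} (hl : -(1 / 2) ≤ l) {Q : ℝ → ℂ}
    (hQ : Continuous Q) {M : ℝ} (hM : ∀ x, ‖Q x‖ ≤ M) :
    ∃ R : ℝ × ℝ → ℂ, Continuous R ∧ ∀ ω : ℂ, ∃ v : ℝ → ℂ, ∀ x, 0 < x →
      HasDerivAt (fun x => charCos ω (fun z => (besselKernel l z : ℂ)) x + charCos ω R x) (v x) x ∧
      HasDerivAt v ((besselPotential l Q x - ω ^ 2) *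
        (charCos ω (fun z => (besselKernel l z : ℂ)) x + charCos ω R x)) x := by
  have hl' : -1 < l := by linarith
  obtain ⟨R, hR, hinteg, hfix⟩ := exists_bessel_goursat_solution hl hQ hM
  refine ⟨R, hR, fun ω => ?_⟩
  obtain ⟨w, hw⟩ := exists_hasDerivAt_blFn hl' ω
  set A : ℂ := (((4 : ℝ) ^ (-l) / 2 * Real.sqrt Real.pi * Real.Gamma (l + 1) /
    Real.Gamma (l + 3 / 2) : ℝ) : ℂ)
  have hK : ∀ x, 0 < x → charCos ω (fun z => (besselKernel l z : ℂ)) x = A * blFn l ω x :=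
    fun x hx => charCos_besselKernel hl' ω hx
  set F : ℝ × ℝ → ℂ := fun z =>
    Q (z.1 + z.2) * besselKernel l z + besselPotential l Q (z.1 + z.2) * R z with hF
  have hsrc : ∀ x, 0 < x → charCos ω F x =
      Q x * (A * blFn l ω x) + besselPotential l Q x * charCos ω R x := fun x hx => by
    rw [hF, charCos_bessel_source hl' Q hR ω hx.le, hK x hx]
  have hsrcc : ContinuousOn (charCos ω F) (Set.Ioi 0) := by
    refine ContinuousOn.congr (f := fun x => Q x * (A * blFn l ω x) +
      besselPotential l Q x * charCos ω R x) ?_ hsrc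
    have hb : ContinuousOn (blFn l ω) (Set.Ioi 0) :=
      fun x hx => (hw x hx).1.continuousAt.continuousWithinAt
    have hp : ContinuousOn (besselPotential l Q) (Set.Ioi 0) := by
      refine ContinuousOn.add (Complex.continuous_ofReal.comp_continuousOn ?_) hQ.continuousOn
      exact continuousOn_const.div (by fun_prop) fun x hx => pow_ne_zero 2 (ne_of_gt hx)
    exact (hQ.continuousOn.mul (hb.const_mul A)).add
      (hp.mul (continuous_charCos ω hR).continuousOn)
  obtain ⟨v, hv⟩ := exists_hasDerivAt_duhamel (ω := ω) (h := charCos ω F) (v := charCos ω R)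
    (fun x hx => (charCos_integral_originRect hinteg ω hx.le).1) hsrcc fun x hx => by
      rw [← (charCos_integral_originRect hinteg ω hx.le).2, ← funext hfix]
  refine ⟨fun x => A * w x + v x, fun x hx => ⟨?_, ?_⟩⟩
  · refine (((hw x hx).1.const_mul A).add (hv x hx).1).congr_of_eventuallyEq ?_
    filter_upwards [Ioi_mem_nhds hx] with y hy
    rw [hK y hy]
    rfl
  · refine (((hw x hx).2.const_mul A).add (hv x hx).2).congr_deriv ?_
    rw [hK x hx, hsrc x hx, besselPotential]
    ring

/-- existence of a continuous transmutation kernel R⁽⁰⁾ such that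
`u(x) = (√π Γ(l+1)/(2^{l+3/2} Γ(l+3/2)²)) 𝐛_l(ω,x) + ∫_0^x R⁽⁰⁾(x,t) cos(ωt) dt`
is a regular solution of the perturbed Bessel equation for every ω ∈ ℂ. -/
theorem stmt4 (b l : ℝ) (hb : 0 < b) (hl : -(1/2) ≤ l) (q : ℝ → ℂ)
    (hq : ContinuousOn q (Set.Icc 0 b)) :
    ∃ R0 : ℝ → ℝ → ℂ,
      ContinuousOn (fun p : ℝ × ℝ => R0 p.1 p.2)
        {p : ℝ × ℝ | 0 ≤ p.2 ∧ p.2 ≤ p.1 ∧ p.1 ≤ b} ∧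
      ∀ ω : ℂ, ∃ u : ℝ → ℂ,
        (∀ y : ℝ, u y =
          ((Real.sqrt Real.pi * Real.Gamma (l+1) /
              (2 ^ (l + 3/2) * (Real.Gamma (l + 3/2))^2) : ℝ) : ℂ) * blFn l ω y
            + ∫ t in (0:ℝ)..y, R0 y t * Complex.cos (ω * t)) ∧
        ∀ x ∈ Set.Ioc (0:ℝ) b,
          DifferentiableAt ℝ u x ∧ DifferentiableAt ℝ (deriv u) x ∧
          -(deriv (deriv u) x) + (((l*(l+1)/x^2 : ℝ) : ℂ) + q x) * u x = ω^2 * u x := by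
  set Q : ℝ → ℂ := Set.IccExtend hb.le ((Set.Icc 0 b).domRestrict q)
  have hQ : Continuous Q := hq.domRestrict.Icc_extend'
  have hQq : ∀ x ∈ Set.Icc 0 b, Q x = q x := fun x hx => Set.IccExtend_of_mem hb.le _ hx
  obtain ⟨M, hM⟩ := isCompact_Icc.exists_bound_of_continuousOn hq
  have hQM : ∀ x, ‖Q x‖ ≤ M := fun x => hM _ (Set.projIcc 0 b hb.le x).2
  obtain ⟨R, hR, hsol⟩ := exists_bessel_cosine_kernel hl hQ hQM
  set A : ℝ := (4 : ℝ) ^ (-l) / 2 * Real.sqrt Real.pi * Real.Gamma (l + 1) /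
    Real.Gamma (l + 3 / 2) with hA
  set c : ℝ := Real.sqrt Real.pi * Real.Gamma (l + 1) /
    (2 ^ (l + 3 / 2) * (Real.Gamma (l + 3 / 2)) ^ 2)
  have hA0 : (A : ℂ) ≠ 0 := by
    have h1 : 0 < Real.Gamma (l + 1) := Real.Gamma_pos_of_pos (by linarith)
    have h2 : 0 < Real.Gamma (l + 3 / 2) := Real.Gamma_pos_of_pos (by linarith)
    have h3 : 0 < A := by rw [hA]; positivity
    exact_mod_cast h3.ne'
  refine ⟨fun x t => (c / A : ℂ) *
    (1 / 2 * (R ((x + t) / 2, (x - t) / 2) + R ((x - t) / 2, (x + t) / 2))),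
    Continuous.continuousOn (by fun_prop), fun ω => ?_⟩
  obtain ⟨v, hv⟩ := hsol ω
  set w : ℝ → ℂ := fun x => charCos ω (fun z => (besselKernel l z : ℂ)) x + charCos ω R x with hw
  set u : ℝ → ℂ := fun y => (c : ℂ) * blFn l ω y + ∫ t in (0 : ℝ)..y, (c / A : ℂ) *
    (1 / 2 * (R ((y + t) / 2, (y - t) / 2) + R ((y - t) / 2, (y + t) / 2))) *
      Complex.cos (ω * t) with hu
  refine ⟨u, fun y => rfl, fun x hx => ?_⟩
  have huw : ∀ y, 0 < y → u y = (c / A : ℂ) * w y := by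
    intro y hy
    simp only [hu, hw, mul_assoc (c / A : ℂ)]
    rw [intervalIntegral.integral_const_mul, ← charCos_eq_integral_cos ω hR,
      charCos_besselKernel (by linarith) ω hy, ← hA]
    field_simp
  have hd : ∀ y, 0 < y → HasDerivAt u ((c / A : ℂ) * v y) y := fun y hy => by
    refine ((hv y hy).1.const_mul (c / A : ℂ)).congr_of_eventuallyEq ?_
    filter_upwards [Ioi_mem_nhds hy] with z hz using huw z hz
  have hdd : HasDerivAt (deriv u) ((c / A : ℂ) * ((besselPotential l Q x - ω ^ 2) * w x)) x := by
    refine ((hv x hx.1).2.const_mul (c / A : ℂ)).congr_of_eventuallyEq ?_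
    filter_upwards [Ioi_mem_nhds hx.1] with z hz using (hd z hz).deriv
  refine ⟨(hd x hx.1).differentiableAt, hdd.differentiableAt, ?_⟩
  rw [hdd.deriv, huw x hx.1, besselPotential, hQq x ⟨hx.1.le, hx.2⟩]
  ring
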